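/- Let G be a connected simple graph with a cut edge (bridge) e = w_1w_2 such that both w_1 and w_2 have degree at least 2 in G. Let G' be the graph on the same vertex set obtained from G by contracting the edge e and attaching a pendant edge at the contracted vertex; concretely, in G' the vertex w_2 is adjacent only to w_1, the vertex w_1 is adjacent to w_2 and to every vertex of (N_G(w_1) ∪ N_G(w_2)) \ {w_1, w_2}, and all adjacencies among the remaining vertices are as in G. Then ρ(G') > ρ(G). -/

import Mathlib

open scoped Classical

noncomputable def hararyMatrix {V : Type*} [Finite V] (G : SimpleGraph V) : Matrix V V ℝ :=
  Matrix.of fun i j => if i = j then 0 else ((G.dist i j : ℝ))⁻¹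

noncomputable def hararyRho {V : Type*} [Finite V] (G : SimpleGraph V) : ℝ :=
  letI := Fintype.ofFinite V
  sSup {μ : ℝ | Module.End.HasEigenvalue (Matrix.toLin' (hararyMatrix G)) μ}

open Matrix

section Spectral

variable {V : Type*} [Fintype V]

theorem Matrix.hasEigenvalue_toLin'_iff (A : Matrix V V ℝ) (μ : ℝ) :
    Module.End.HasEigenvalue (Matrix.toLin' A) μ ↔ ∃ x : V → ℝ, x ≠ 0 ∧ A *ᵥ x = μ • x := by
  constructor
  · intro h
    obtain ⟨x, hx⟩ := h.exists_hasEigenvector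
    exact ⟨x, hx.2, by simpa using hx.apply_eq_smul⟩
  · rintro ⟨x, hx, h⟩
    exact Module.End.hasEigenvalue_of_hasEigenvector
      ⟨Module.End.mem_eigenspace_iff.2 (by simpa using h), hx⟩

theorem Matrix.finite_setOf_hasEigenvalue_toLin' (A : Matrix V V ℝ) :
    {μ : ℝ | Module.End.HasEigenvalue (Matrix.toLin' A) μ}.Finite := by
  have h := Module.End.finite_spectrum (Matrix.toLin' A)
  simp_rw [Module.End.hasEigenvalue_iff_mem_spectrum]
  exact h

theorem Matrix.IsHermitian.exists_mulVec_eq_sSup_smul [Nonempty V] {A : Matrix V V ℝ}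
    (hA : A.IsHermitian) :
    ∃ x : V → ℝ, x ≠ 0 ∧
      A *ᵥ x = sSup {μ : ℝ | Module.End.HasEigenvalue (Matrix.toLin' A) μ} • x := by
  rw [← Matrix.hasEigenvalue_toLin'_iff]
  refine Set.Nonempty.csSup_mem (s := {μ : ℝ | Module.End.HasEigenvalue (Matrix.toLin' A) μ})
    ⟨hA.eigenvalues (Classical.arbitrary V), ?_⟩ (Matrix.finite_setOf_hasEigenvalue_toLin' A)
  rw [Set.mem_ofPred_eq, Module.End.hasEigenvalue_iff_mem_spectrum, Matrix.spectrum_toLin']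
  exact hA.eigenvalues_mem_spectrum_real _

theorem Matrix.IsHermitian.posSemidef_sSup_smul_one_sub {A : Matrix V V ℝ}
    (hA : A.IsHermitian) :
    (sSup {μ : ℝ | Module.End.HasEigenvalue (Matrix.toLin' A) μ} • (1 : Matrix V V ℝ)
      - A).PosSemidef := by
  set ρ := sSup {μ : ℝ | Module.End.HasEigenvalue (Matrix.toLin' A) μ}
  have hB : (ρ • (1 : Matrix V V ℝ) - A).IsHermitian := by
    refine Matrix.IsHermitian.sub ?_ hA
    simp [Matrix.IsHermitian]
  rw [hB.posSemidef_iff_eigenvalues_nonneg]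
  intro i
  have hi := hB.eigenvalues_mem_spectrum_real i
  rw [← Matrix.spectrum_toLin', ← Module.End.hasEigenvalue_iff_mem_spectrum,
    Matrix.hasEigenvalue_toLin'_iff] at hi
  obtain ⟨x, hx, h⟩ := hi
  have : ρ - hB.eigenvalues i ≤ ρ := by
    refine le_csSup (Matrix.finite_setOf_hasEigenvalue_toLin' A).bddAbove ?_
    refine (Matrix.hasEigenvalue_toLin'_iff _ _).2 ⟨x, hx, ?_⟩
    rw [Matrix.sub_mulVec, Matrix.smul_mulVec, Matrix.one_mulVec] at h
    rw [sub_smul, ← h]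
    abel
  simpa using this

end Spectral

section Harary

variable {V : Type*} [Fintype V]

theorem hararyMatrix_apply (G : SimpleGraph V) (i j : V) :
    hararyMatrix G i j = ((G.dist i j : ℝ))⁻¹ := by
  by_cases h : i = j <;> simp [hararyMatrix, h]

theorem hararyMatrix_isHermitian (G : SimpleGraph V) : (hararyMatrix G).IsHermitian := by
  ext i j
  simp [hararyMatrix_apply, SimpleGraph.dist_comm]

theorem hararyRho_eq (G : SimpleGraph V) :
    hararyRho G = sSup {μ : ℝ | Module.End.HasEigenvalue (Matrix.toLin' (hararyMatrix G)) μ} := by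
  unfold hararyRho
  convert rfl

theorem hararyMatrix_posSemidef (G : SimpleGraph V) :
    (hararyRho G • (1 : Matrix V V ℝ) - hararyMatrix G).PosSemidef := by
  rw [hararyRho_eq]
  exact (hararyMatrix_isHermitian G).posSemidef_sSup_smul_one_sub

theorem hararyMatrix_quadratic_le (G : SimpleGraph V) (x : V → ℝ) :
    x ⬝ᵥ hararyMatrix G *ᵥ x ≤ hararyRho G * (x ⬝ᵥ x) := by
  have h := (hararyMatrix_posSemidef G).dotProduct_mulVec_nonneg x
  simp only [star_trivial, Matrix.sub_mulVec, Matrix.smul_mulVec, Matrix.one_mulVec,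
    dotProduct_sub, dotProduct_smul, smul_eq_mul] at h
  linarith

/-- Perron vector of the Harary matrix. -/
theorem exists_pos_hararyMatrix_mulVec_eq {G : SimpleGraph V} (hG : G.Connected) :
    ∃ x : V → ℝ, (∀ i, 0 < x i) ∧ hararyMatrix G *ᵥ x = hararyRho G • x := by
  have := hG.nonempty
  obtain ⟨x, hx0, hx⟩ := (hararyMatrix_isHermitian G).exists_mulVec_eq_sSup_smul
  rw [← hararyRho_eq] at hx
  have hA : ∀ i j, 0 ≤ hararyMatrix G i j := fun i j => by
    rw [hararyMatrix_apply]; positivity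
  have hquad : x ⬝ᵥ hararyMatrix G *ᵥ x ≤ |x| ⬝ᵥ hararyMatrix G *ᵥ |x| := by
    simp only [dotProduct, Matrix.mulVec, Finset.mul_sum]
    refine Finset.sum_le_sum fun i _ => Finset.sum_le_sum fun j _ => ?_
    refine (le_abs_self _).trans_eq ?_
    rw [abs_mul, abs_mul, abs_of_nonneg (hA i j), Pi.abs_apply, Pi.abs_apply]
  have hnorm : |x| ⬝ᵥ |x| = x ⬝ᵥ x := by
    simp [dotProduct]
  have hmax : hararyMatrix G *ᵥ |x| = hararyRho G • |x| := by
    have h0 := ((hararyMatrix_posSemidef G).dotProduct_mulVec_zero_iff |x|).1 (by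
      have h1 := hararyMatrix_quadratic_le G |x|
      rw [hx, dotProduct_smul, smul_eq_mul] at hquad
      simp only [star_trivial, Matrix.sub_mulVec, Matrix.smul_mulVec, Matrix.one_mulVec,
        dotProduct_sub, dotProduct_smul, smul_eq_mul]
      rw [hnorm] at *
      linarith)
    rw [Matrix.sub_mulVec, Matrix.smul_mulVec, Matrix.one_mulVec] at h0
    exact (sub_eq_zero.1 h0).symm
  refine ⟨|x|, fun i => ?_, hmax⟩
  refine (abs_nonneg (x i)).lt_of_ne fun hi => hx0 (funext fun j => ?_)
  have hi' : |x| i = 0 := hi.symm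
  have hxnn : ∀ j, 0 ≤ |x| j := fun j => abs_nonneg (x j)
  have hsum := congrFun hmax i
  rw [Pi.smul_apply, hi', smul_zero, Matrix.mulVec, dotProduct,
    Finset.sum_eq_zero_iff_of_nonneg fun j _ => mul_nonneg (hA i j) (hxnn j)] at hsum
  by_cases hij : i = j
  · subst hij
    simpa using hi'
  · have h := hsum j (Finset.mem_univ j)
    have hd := (hG.pos_dist_of_ne hij).ne'
    simpa [hararyMatrix_apply, hd] using h

end Harary

namespace SimpleGraph

variable {V W : Type*}

theorem exists_walk_length_le_of_adj_imp {G : SimpleGraph V} {H : SimpleGraph W} (f : V → W)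
    (hf : ∀ u v, G.Adj u v → f u = f v ∨ H.Adj (f u) (f v)) {u v : V} (p : G.Walk u v) :
    ∃ q : H.Walk (f u) (f v), q.length ≤ p.length := by
  induction p with
  | nil => exact ⟨.nil, le_rfl⟩
  | cons h p ih =>
    obtain ⟨q, hq⟩ := ih
    rcases hf _ _ h with h | h
    · exact ⟨q.copy h.symm rfl, by simp; omega⟩
    · exact ⟨.cons h q, by simp; omega⟩

theorem dist_comap_equiv (H : SimpleGraph W) (e : V ≃ W) (u v : V) :
    (H.comap e).dist u v = H.dist (e u) (e v) := by
  have hiso := (Iso.comap e H).reachable_iff (u := u) (v := v)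
  by_cases hr : (H.comap e).Reachable u v
  · have hr' := hiso.2 hr
    apply le_antisymm
    · obtain ⟨p, hp⟩ := hr'.exists_walk_length_eq_dist
      have h := dist_le (p.map (Iso.comap e H).symm.toHom)
      rw [Walk.length_map, hp] at h
      refine (le_of_eq ?_).trans h
      exact congrArg₂ (H.comap e).dist (e.symm_apply_apply u).symm (e.symm_apply_apply v).symm
    · obtain ⟨p, hp⟩ := hr.exists_walk_length_eq_dist
      have h := dist_le (p.map (Iso.comap e H).toHom)
      rw [Walk.length_map, hp] at h
      exact h
  · have hr' : ¬ H.Reachable (e u) (e v) := fun h => hr (hiso.1 h)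
    rw [dist_eq_zero_of_not_reachable hr, dist_eq_zero_of_not_reachable hr']

theorem dist_add_one_add_dist_le_of_bridge {G : SimpleGraph V} (hG : G.Connected) {w₁ w₂ : V}
    {a b : V} (ha : (G.deleteEdges {s(w₁, w₂)}).Reachable w₁ a)
    (hb : ¬ (G.deleteEdges {s(w₁, w₂)}).Reachable w₁ b) :
    G.dist w₁ a + 1 + G.dist w₂ b ≤ G.dist a b := by
  obtain ⟨p, hp⟩ := hG.exists_walk_length_eq_dist a b
  rw [← hp]
  clear hp
  induction p with
  | nil => exact absurd ha hb
  | @cons u v b h p ih =>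
    rw [Walk.length_cons]
    by_cases hv : (G.deleteEdges {s(w₁, w₂)}).Reachable w₁ v
    · have h1 := ih hv hb
      have h2 : G.dist w₁ u ≤ G.dist w₁ v + G.dist v u := hG.dist_triangle
      rw [dist_eq_one_iff_adj.2 h.symm] at h2
      omega
    · have he : s(u, v) = s(w₁, w₂) := by
        by_contra he
        refine hv (ha.trans (Adj.reachable ?_))
        rw [deleteEdges_adj]
        exact ⟨h, he⟩
      rw [Sym2.eq_iff] at he
      rcases he with ⟨rfl, rfl⟩ | ⟨rfl, rfl⟩
      · have := dist_le p
        rw [dist_self]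
        omega
      · exact absurd (Reachable.refl _) hv

end SimpleGraph

section Contraction

open SimpleGraph

variable {V : Type*}

theorem Finset.sum_sum_pos_of_pair [Fintype V] {f : V → V → ℝ} {w₁ w₂ : V} (hw : w₁ ≠ w₂)
    (hsymm : ∀ i j, f i j = f j i) (h11 : f w₁ w₁ = 0) (h22 : f w₂ w₂ = 0)
    (h12 : 0 ≤ f w₁ w₂) (hpair : ∀ v, v ≠ w₁ → v ≠ w₂ → 0 ≤ f w₁ v + f w₂ v)
    (hrest : ∀ u v, u ≠ w₁ → u ≠ w₂ → v ≠ w₁ → v ≠ w₂ → 0 ≤ f u v)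
    (hpos : ∃ u v, (u ≠ w₁ ∧ u ≠ w₂ ∧ v ≠ w₁ ∧ v ≠ w₂) ∧ 0 < f u v) :
    0 < ∑ i, ∑ j, f i j := by
  have hsplit : ∀ g : V → ℝ, ∑ i, g i = g w₁ + g w₂ + ∑ i ∈ {w₁, w₂}ᶜ, g i := fun g => by
    rw [← Finset.sum_pair hw, Finset.sum_add_sum_compl]
  have hmem : ∀ {v}, v ∈ ({w₁, w₂}ᶜ : Finset V) ↔ v ≠ w₁ ∧ v ≠ w₂ := by simp
  have h1 : 0 ≤ ∑ v ∈ {w₁, w₂}ᶜ, (f w₁ v + f w₂ v) :=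
    Finset.sum_nonneg fun v hv => hpair v (hmem.1 hv).1 (hmem.1 hv).2
  have h2 : 0 < ∑ u ∈ {w₁, w₂}ᶜ, ∑ v ∈ {w₁, w₂}ᶜ, f u v := by
    obtain ⟨u, v, ⟨hu1, hu2, hv1, hv2⟩, huv⟩ := hpos
    refine Finset.sum_pos' (fun i hi => Finset.sum_nonneg fun j hj =>
      hrest i j (hmem.1 hi).1 (hmem.1 hi).2 (hmem.1 hj).1 (hmem.1 hj).2)
      ⟨u, hmem.2 ⟨hu1, hu2⟩, Finset.sum_pos' (fun j hj =>
        hrest u j hu1 hu2 (hmem.1 hj).1 (hmem.1 hj).2) ⟨v, hmem.2 ⟨hv1, hv2⟩, huv⟩⟩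
  have h3 : ∑ i, ∑ j, f i j = 2 * f w₁ w₂ + 2 * ∑ v ∈ {w₁, w₂}ᶜ, (f w₁ v + f w₂ v)
      + ∑ u ∈ {w₁, w₂}ᶜ, ∑ v ∈ {w₁, w₂}ᶜ, f u v := by
    have h4 : ∀ w, ∑ v ∈ {w₁, w₂}ᶜ, f v w = ∑ v ∈ {w₁, w₂}ᶜ, f w v := fun w =>
      Finset.sum_congr rfl fun v _ => hsymm v w
    simp only [hsplit, Finset.sum_add_distrib]
    rw [h4 w₁, h4 w₂, h11, h22, hsymm w₂ w₁]
    ring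
  linarith

/-- The Harary quadratic form increases under contraction of the bridge `w₁w₂` when the
weight of the vertex `w₁`, that receives the pendant edge, is at least that of `w₂`. -/
theorem hararyMatrix_quadratic_lt_of_contract_bridge [Fintype V] {G : SimpleGraph V}
    (hG : G.Connected) {w₁ w₂ : V} (hadj : G.Adj w₁ w₂) (hbridge : G.IsBridge s(w₁, w₂))
    (hd₁ : 2 ≤ (G.neighborSet w₁).ncard) (hd₂ : 2 ≤ (G.neighborSet w₂).ncard)
    {H : SimpleGraph V}
    (hH₂ : ∀ v, H.Adj w₂ v ↔ v = w₁)
    (hH₁ : ∀ v, v ≠ w₁ → v ≠ w₂ → (H.Adj w₁ v ↔ (G.Adj w₁ v ∨ G.Adj w₂ v)))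
    (hHrest : ∀ u v, u ≠ w₁ → u ≠ w₂ → v ≠ w₁ → v ≠ w₂ → (H.Adj u v ↔ G.Adj u v))
    {x : V → ℝ} (hx : ∀ i, 0 < x i) (hle : x w₂ ≤ x w₁) :
    x ⬝ᵥ hararyMatrix G *ᵥ x < x ⬝ᵥ hararyMatrix H *ᵥ x := by
  have hw : w₁ ≠ w₂ := hadj.ne
  have hHw : H.Adj w₁ w₂ := ((hH₂ w₁).2 rfl).symm
  have hcontr : ∀ u v, ∃ q : H.Walk (if u = w₂ then w₁ else u) (if v = w₂ then w₁ else v),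
      q.length ≤ G.dist u v := by
    intro u v
    obtain ⟨p, hp⟩ := hG.exists_walk_length_eq_dist u v
    rw [← hp]
    refine exists_walk_length_le_of_adj_imp (fun u => if u = w₂ then w₁ else u) ?_ p
    intro u v huv
    have hG' := huv.symm
    have hH' : ∀ a b, H.Adj a b → H.Adj b a := fun _ _ h => h.symm
    by_cases hu : u = w₁ <;> by_cases hv : v = w₁ <;> split_ifs <;> grind
  have hHconn : H.Connected := by
    have hr : ∀ u, H.Reachable w₁ u := fun u => by
      by_cases hu : u = w₂
      · exact hu ▸ hHw.reachable
      · obtain ⟨q, -⟩ := hcontr w₁ u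
        rw [if_neg hw, if_neg hu] at q
        exact q.reachable
    exact { preconnected := fun u v => (hr u).symm.trans (hr v), nonempty := ⟨w₁⟩ }
  have hdist : ∀ u v, u ≠ w₂ → v ≠ w₂ → H.dist u v ≤ G.dist u v := fun u v hu hv => by
    obtain ⟨q, hq⟩ := hcontr u v
    simpa [hu, hv] using (dist_le q).trans hq
  have hdist₂ : ∀ v, v ≠ w₂ → H.dist w₁ v ≤ G.dist w₂ v := fun v hv => by
    obtain ⟨q, hq⟩ := hcontr w₂ v
    simpa [hv] using (dist_le q).trans hq
  have hpend : ∀ v, H.dist w₂ v ≤ 1 + H.dist w₁ v := fun v => by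
    have := hHconn.dist_triangle (u := w₂) (v := w₁) (w := v)
    rwa [dist_eq_one_iff_adj.2 hHw.symm] at this
  have hne : ∀ v, G.dist w₁ v + 1 ≤ G.dist w₂ v ∨ G.dist w₂ v + 1 ≤ G.dist w₁ v := fun v => by
    by_cases hv : (G.deleteEdges {s(w₁, w₂)}).Reachable w₁ v
    · left
      have := dist_add_one_add_dist_le_of_bridge hG hv hbridge
      rw [SimpleGraph.dist_self, SimpleGraph.dist_comm (u := v)] at this
      exact this
    · right
      have := dist_add_one_add_dist_le_of_bridge hG (Reachable.refl w₁) hv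
      rw [SimpleGraph.dist_self] at this
      omega
  have hinv : ∀ {m n : ℕ}, 0 < m → m ≤ n → (n : ℝ)⁻¹ ≤ (m : ℝ)⁻¹ := fun hm hmn =>
    inv_anti₀ (by exact_mod_cast hm) (by exact_mod_cast hmn)
  have hpos := Finset.sum_sum_pos_of_pair (w₁ := w₁) (w₂ := w₂)
    (f := fun i j => (hararyMatrix H i j - hararyMatrix G i j) * (x i * x j)) hw
    (fun i j => by
      simp only [hararyMatrix_apply, H.dist_comm (u := i), G.dist_comm (u := i)]; ring)
    (by simp [hararyMatrix_apply]) (by simp [hararyMatrix_apply])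
    (by simp [hararyMatrix_apply, dist_eq_one_iff_adj.2 hadj, dist_eq_one_iff_adj.2 hHw])
    ?_ ?_ ?_
  · have : x ⬝ᵥ hararyMatrix H *ᵥ x - x ⬝ᵥ hararyMatrix G *ᵥ x =
        ∑ i, ∑ j, (hararyMatrix H i j - hararyMatrix G i j) * (x i * x j) := by
      simp only [dotProduct, Matrix.mulVec, Finset.mul_sum, ← Finset.sum_sub_distrib]
      refine Finset.sum_congr rfl fun i _ => Finset.sum_congr rfl fun j _ => by ring
    linarith
  · intro v hv1 hv2
    simp only [hararyMatrix_apply]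
    have h1 := hHconn.pos_dist_of_ne (Ne.symm hv1)
    have h2 := hHconn.pos_dist_of_ne (Ne.symm hv2)
    have g1 := hG.pos_dist_of_ne (Ne.symm hv1)
    have g2 := hG.pos_dist_of_ne (Ne.symm hv2)
    have h3 := hdist w₁ v hw hv2
    have h4 := hdist₂ v hv2
    have h5 := hpend v
    have hx1 := hx w₁
    have hx2 := hx w₂
    suffices h : 0 ≤ ((H.dist w₁ v : ℝ)⁻¹ - (G.dist w₁ v : ℝ)⁻¹) * x w₁ +
        ((H.dist w₂ v : ℝ)⁻¹ - (G.dist w₂ v : ℝ)⁻¹) * x w₂ by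
      have := mul_nonneg h (hx v).le
      linarith
    rcases hne v with h | h
    · have i1 := hinv h1 h3
      have i2 := hinv h2 (by omega : H.dist w₂ v ≤ G.dist w₂ v)
      have := mul_nonneg (sub_nonneg.2 i1) hx1.le
      have := mul_nonneg (sub_nonneg.2 i2) hx2.le
      linarith
    · have i1 := hinv h1 h4
      have i2 := hinv h2 (by omega : H.dist w₂ v ≤ G.dist w₁ v)
      have i3 := hinv g2 (by omega : G.dist w₂ v ≤ G.dist w₁ v)
      have j1 := mul_nonneg (sub_nonneg.2 i1) hx1.le
      have j2 := mul_nonneg (sub_nonneg.2 i2) hx2.le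
      have j3 := mul_nonneg (sub_nonneg.2 i3) (sub_nonneg.2 hle)
      linarith
  · intro u v _ hu2 _ hv2
    by_cases huv : u = v
    · simp [huv, hararyMatrix_apply]
    · have := hinv (hHconn.pos_dist_of_ne huv) (hdist u v hu2 hv2)
      rw [hararyMatrix_apply, hararyMatrix_apply]
      exact mul_nonneg (sub_nonneg.2 this) (mul_pos (hx u) (hx v)).le
  · obtain ⟨a, ha, ha2⟩ := Set.exists_ne_of_one_lt_ncard (s := G.neighborSet w₁) (by omega) w₂
    obtain ⟨b, hb, hb1⟩ := Set.exists_ne_of_one_lt_ncard (s := G.neighborSet w₂) (by omega) w₁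
    rw [SimpleGraph.mem_neighborSet] at ha hb
    have ha1 : a ≠ w₁ := ha.ne'
    have hb2 : b ≠ w₂ := hb.ne'
    have hra : (G.deleteEdges {s(w₁, w₂)}).Reachable w₁ a := Adj.reachable <| by
      rw [deleteEdges_adj]
      refine ⟨ha, ?_⟩
      simp [ha2, ha1, hw]
    have hrb : ¬ (G.deleteEdges {s(w₁, w₂)}).Reachable w₁ b := fun h =>
      hbridge <| h.trans <| Adj.reachable <| by
        rw [deleteEdges_adj]
        refine ⟨hb.symm, ?_⟩
        simp [hb2, hb1]
    have hab := dist_add_one_add_dist_le_of_bridge hG hra hrb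
    rw [dist_eq_one_iff_adj.2 ha, dist_eq_one_iff_adj.2 hb] at hab
    have hHa : H.Adj w₁ a := (hH₁ a ha1 ha2).2 (.inl ha)
    have hHb : H.Adj w₁ b := (hH₁ b hb1 hb2).2 (.inr hb)
    have hHab : H.dist a b ≤ 2 := dist_le (.cons hHa.symm (.cons hHb .nil))
    have hne' : a ≠ b := fun h => hrb (h ▸ hra)
    refine ⟨a, b, ⟨ha1, ha2, hb1, hb2⟩, ?_⟩
    rw [hararyMatrix_apply, hararyMatrix_apply]
    refine mul_pos (sub_pos.2 (inv_strictAnti₀ ?_ ?_)) (mul_pos (hx a) (hx b))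
    · exact_mod_cast hHconn.pos_dist_of_ne hne'
    · exact_mod_cast (by omega : H.dist a b < G.dist a b)

theorem hararyMatrix_comap_quadratic [Fintype V] (H : SimpleGraph V) (e : V ≃ V) (x : V → ℝ) :
    x ⬝ᵥ hararyMatrix (H.comap e) *ᵥ x =
      (x ∘ e.symm) ⬝ᵥ hararyMatrix H *ᵥ (x ∘ e.symm) := by
  simp only [dotProduct, Matrix.mulVec]
  rw [← Equiv.sum_comp e fun i => (x ∘ e.symm) i * ∑ j, hararyMatrix H i j * (x ∘ e.symm) j]
  refine Finset.sum_congr rfl fun i _ => ?_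
  rw [← Equiv.sum_comp e fun j => hararyMatrix H (e i) j * (x ∘ e.symm) j]
  simp [hararyMatrix_apply, dist_comap_equiv]

end Contraction

/-- Contracting a cut edge `w₁w₂` (both endpoints of degree at least 2) and attaching a
pendant edge at the contracted vertex strictly increases the Harary spectral radius.
Here `H` is the resulting graph on the same vertex set: `w₂` is a pendant vertex adjacent
only to `w₁`, the vertex `w₁` is adjacent to `w₂` and to every vertex of
`(N_G(w₁) ∪ N_G(w₂)) \ {w₁, w₂}`, and all other adjacencies are as in `G`. -/
theorem harary_rho_contract_bridge_lt {V : Type*} [Finite V] (G : SimpleGraph V)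
    (hG : G.Connected) (w₁ w₂ : V) (hadj : G.Adj w₁ w₂)
    (hbridge : G.IsBridge s(w₁, w₂))
    (hd₁ : 2 ≤ (G.neighborSet w₁).ncard) (hd₂ : 2 ≤ (G.neighborSet w₂).ncard)
    (H : SimpleGraph V)
    (hH₂ : ∀ v, H.Adj w₂ v ↔ v = w₁)
    (hH₁ : ∀ v, v ≠ w₁ → v ≠ w₂ → (H.Adj w₁ v ↔ (G.Adj w₁ v ∨ G.Adj w₂ v)))
    (hHrest : ∀ u v, u ≠ w₁ → u ≠ w₂ → v ≠ w₁ → v ≠ w₂ → (H.Adj u v ↔ G.Adj u v)) :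
    hararyRho G < hararyRho H := by
  let := Fintype.ofFinite V
  obtain ⟨x, hx, hGx⟩ := exists_pos_hararyMatrix_mulVec_eq hG
  have hquad : x ⬝ᵥ hararyMatrix G *ᵥ x = hararyRho G * (x ⬝ᵥ x) := by
    rw [hGx, dotProduct_smul, smul_eq_mul]
  have hxx : 0 < x ⬝ᵥ x :=
    Finset.sum_pos (fun i _ => mul_pos (hx i) (hx i)) ⟨w₁, Finset.mem_univ _⟩
  refine lt_of_mul_lt_mul_right ?_ hxx.le
  rw [← hquad]
  rcases le_total (x w₂) (x w₁) with hle | hle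
  · exact (hararyMatrix_quadratic_lt_of_contract_bridge hG hadj hbridge hd₁ hd₂ hH₂ hH₁ hHrest
      hx hle).trans_le (hararyMatrix_quadratic_le H x)
  · have hlt := hararyMatrix_quadratic_lt_of_contract_bridge
      (H := H.comap (Equiv.swap w₁ w₂)) hG hadj.symm (Sym2.eq_swap ▸ hbridge) hd₂ hd₁
      (fun v => by
        rw [SimpleGraph.comap_adj, Equiv.swap_apply_left, hH₂, Equiv.swap_apply_eq_iff,
          Equiv.swap_apply_left])
      (fun v hv2 hv1 => by
        rw [SimpleGraph.comap_adj, Equiv.swap_apply_right,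
          Equiv.swap_apply_of_ne_of_ne hv1 hv2, hH₁ v hv1 hv2, or_comm])
      (fun u v hu2 hu1 hv2 hv1 => by
        rw [SimpleGraph.comap_adj, Equiv.swap_apply_of_ne_of_ne hu1 hu2,
          Equiv.swap_apply_of_ne_of_ne hv1 hv2, hHrest u v hu1 hu2 hv1 hv2])
      hx hle
    rw [hararyMatrix_comap_quadratic] at hlt
    refine hlt.trans_le ((hararyMatrix_quadratic_le H _).trans_eq ?_)
    simp
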